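/- Let A ∈ ℝ^{n×n} be a normal matrix (AAᵀ = AᵀA) whose eigenvalues ordered by decreasing real part satisfy Re(λ_r(A)) > Re(λ_{r+1}(A)), and let S ∈ ℂ^{n×n} be unitary with SᵈAS = diag(λ₁(A),…,λ_n(A)) in this order. Let U : [0,∞) → ℝ^{n×r} be a solution of the Oja flow U'(t) = (I_n − U(t)U(t)ᵀ)AU(t) with U(0)ᵀU(0) = I_r, and write SᵈU(t) = [F₁(t); F₂(t)] with F₁(t) ∈ ℂ^{r×r}, F₂(t) ∈ ℂ^{(n−r)×r}. If F₂(0)ᵈF₂(0) < I_r in the Loewner order, then F₂(t) → O as t → ∞. -/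

import Mathlib

open Matrix Filter
open scoped ComplexOrder

/-- Embedding of the last `n - r` indices. -/
def embBot {n r : ℕ} : Fin (n - r) → Fin n := fun i => ⟨r + i, by omega⟩

open scoped Matrix.Norms.Elementwise in
/-- A solution of the linear matrix equation `X' = P X + X Q` with `X 0 = 0` vanishes on `[0, ∞)`. -/
theorem eq_zero_of_hasDerivAt_mul_add_mul {𝕜 m k : Type*} [RCLike 𝕜] [Fintype m] [Fintype k]
    {P : ℝ → Matrix m m 𝕜} {Q : ℝ → Matrix k k 𝕜} {X : ℝ → Matrix m k 𝕜}
    (hP : ∀ i j, ContinuousOn (fun s => P s i j) (Set.Ici 0))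
    (hQ : ∀ i j, ContinuousOn (fun s => Q s i j) (Set.Ici 0))
    (hX : ∀ t, 0 ≤ t → ∀ i j,
      HasDerivAt (fun s => X s i j) ((P t * X t + X t * Q t) i j) t)
    (h0 : X 0 = 0) : ∀ t, 0 ≤ t → X t = 0 := by
  intro T hT
  have hPc : ContinuousOn P (Set.Icc 0 T) :=
    (continuousOn_pi.2 fun i => continuousOn_pi.2 fun j => hP i j).mono Set.Icc_subset_Ici_self
  have hQc : ContinuousOn Q (Set.Icc 0 T) :=
    (continuousOn_pi.2 fun i => continuousOn_pi.2 fun j => hQ i j).mono Set.Icc_subset_Ici_self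
  obtain ⟨a, ha⟩ := isCompact_Icc.exists_bound_of_continuousOn hPc
  obtain ⟨b, hb⟩ := isCompact_Icc.exists_bound_of_continuousOn hQc
  have hXd : ∀ t, 0 ≤ t → HasDerivAt X (P t * X t + X t * Q t) t := fun t ht =>
    hasDerivAt_pi.2 fun i => hasDerivAt_pi.2 fun j => hX t ht i j
  refine eq_zero_of_abs_deriv_le_mul_abs_self_of_eq_zero_right
    (K := Fintype.card m * a + Fintype.card k * b) (a := 0) (b := T)
    (fun t ht => (hXd t ht.1).continuousAt.continuousWithinAt)
    (fun t ht => (hXd t ht.1).hasDerivWithinAt) h0 (fun t ht => ?_) T ⟨hT, le_rfl⟩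
  have ha' := ha t ⟨ht.1, ht.2.le⟩
  have hb' := hb t ⟨ht.1, ht.2.le⟩
  have ha0 := (norm_nonneg _).trans ha'
  have hb0 := (norm_nonneg _).trans hb'
  refine (Matrix.norm_le_iff (by positivity)).2 fun i j => ?_
  rw [Matrix.add_apply, add_mul]
  refine (norm_add_le _ _).trans (add_le_add ?_ ?_)
  · rw [Matrix.mul_apply, mul_assoc, ← nsmul_eq_mul]
    refine norm_sum_le_of_le _ (fun l _ => ?_) |>.trans_eq (Finset.sum_const _)
    rw [norm_mul]
    exact mul_le_mul ((Matrix.norm_entry_le_entrywise_sup_norm _).trans ha')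
      (Matrix.norm_entry_le_entrywise_sup_norm _) (norm_nonneg _) ha0
  · rw [Matrix.mul_apply, mul_assoc, ← nsmul_eq_mul]
    refine norm_sum_le_of_le _ (fun l _ => ?_) |>.trans_eq (Finset.sum_const _)
    rw [norm_mul, mul_comm]
    exact mul_le_mul ((Matrix.norm_entry_le_entrywise_sup_norm _).trans hb')
      (Matrix.norm_entry_le_entrywise_sup_norm _) (norm_nonneg _) hb0

/-- The Oja flow preserves the Stiefel manifold. -/
theorem oja_flow_mem_stiefel {m k : Type*} [Fintype m] [Fintype k] [DecidableEq m] [DecidableEq k]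
    (A : Matrix m m ℝ) (U : ℝ → Matrix m k ℝ)
    (hode : ∀ t : ℝ, 0 ≤ t → ∀ i j, HasDerivAt (fun s : ℝ => U s i j)
      ((((1 : Matrix m m ℝ) - U t * (U t)ᵀ) * A * U t) i j) t)
    (hinit : (U 0)ᵀ * U 0 = 1) : ∀ t, 0 ≤ t → (U t)ᵀ * U t = 1 := by
  have hUcont : ∀ i j, ContinuousOn (fun s => U s i j) (Set.Ici 0) := fun i j t ht =>
    (hode t ht i j).continuousAt.continuousWithinAt
  have key : ∀ t, 0 ≤ t → (U t)ᵀ * U t - 1 = 0 := by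
    refine eq_zero_of_hasDerivAt_mul_add_mul (P := fun t => -((U t)ᵀ * Aᵀ * U t))
      (Q := fun t => -((U t)ᵀ * A * U t)) ?_ ?_ ?_ (by rw [hinit, sub_self])
    · intro i j
      simp only [Matrix.neg_apply, Matrix.mul_apply, Matrix.transpose_apply]
      fun_prop (disch := assumption)
    · intro i j
      simp only [Matrix.neg_apply, Matrix.mul_apply, Matrix.transpose_apply]
      fun_prop (disch := assumption)
    · intro t ht i j
      set W := ((1 : Matrix m m ℝ) - U t * (U t)ᵀ) * A * U t with hW
      have h1 : -((U t)ᵀ * Aᵀ * U t) * ((U t)ᵀ * U t - 1)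
          + ((U t)ᵀ * U t - 1) * -((U t)ᵀ * A * U t) = Wᵀ * U t + (U t)ᵀ * W := by
        simp only [hW, Matrix.transpose_mul, Matrix.transpose_sub, Matrix.transpose_transpose,
          Matrix.mul_sub, Matrix.sub_mul, Matrix.mul_one,
          Matrix.one_mul, Matrix.mul_assoc, Matrix.neg_mul, Matrix.mul_neg]
        abel
      rw [h1, Matrix.add_apply]
      simp only [Matrix.sub_apply, Matrix.mul_apply, Matrix.transpose_apply]
      rw [← Finset.sum_add_distrib]
      exact (HasDerivAt.fun_sum fun l _ =>
        (hode t ht l i).fun_mul (hode t ht l j)).sub_const _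
  exact fun t ht => sub_eq_zero.1 (key t ht)

theorem map_ofReal_mul {l m k : Type*} [Fintype m] (M : Matrix l m ℝ) (N : Matrix m k ℝ) :
    (M * N).map Complex.ofReal = M.map Complex.ofReal * N.map Complex.ofReal :=
  Matrix.map_mul (f := Complex.ofRealHom)

theorem conjTranspose_map_ofReal {m k : Type*} (M : Matrix m k ℝ) :
    (M.map Complex.ofReal)ᴴ = Mᵀ.map Complex.ofReal := by
  ext i j
  simp [Matrix.conjTranspose_apply]

theorem sum_eq_sum_castLE_add_sum_embBot {M : Type*} [AddCommMonoid M] {n r : ℕ} (h : r ≤ n)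
    (f : Fin n → M) :
    ∑ i, f i = ∑ i : Fin r, f (Fin.castLE h i) + ∑ i : Fin (n - r), f (embBot i) := by
  obtain ⟨m, rfl⟩ := Nat.exists_eq_add_of_le h
  rw [Fin.sum_univ_add]
  congr 1
  exact Fintype.sum_equiv (finCongr (by omega)) _ _ fun i => rfl

/-- The entries of a matrix with orthonormal columns have norm at most one. -/
theorem norm_apply_le_one_of_conjTranspose_mul_self {𝕜 m k : Type*} [RCLike 𝕜] [Fintype m]
    [DecidableEq k] {V : Matrix m k 𝕜} (hV : Vᴴ * V = 1) (i : m) (j : k) : ‖V i j‖ ≤ 1 := by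
  have h1 : ∑ l, ‖V l j‖ ^ 2 = 1 := by
    have h2 := congr_fun (congr_fun hV j) j
    simp only [Matrix.mul_apply, Matrix.conjTranspose_apply, Matrix.one_apply_eq,
      RCLike.star_def, RCLike.conj_mul] at h2
    exact_mod_cast h2
  have h3 := Finset.single_le_sum (f := fun l => ‖V l j‖ ^ 2) (fun l _ => sq_nonneg _)
    (Finset.mem_univ i)
  exact (sq_le_one_iff₀ (norm_nonneg _)).1 (h3.trans_eq h1)

/-- **Corollary 1 (domain of attraction for normal matrices).**
Let `A ∈ ℝ^{n×n}` be normal and let the unitary `S` diagonalize `A` with the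
eigenvalues ordered by decreasing real part, where `Re λ_r(A) > Re λ_{r+1}(A)`.
If `U` solves the Oja flow on the Stiefel manifold and the bottom block `F₂`
of `SᴴU` satisfies `F₂(0)ᴴF₂(0) < I_r`, then `F₂(t) → 0` as `t → ∞`. -/
theorem oja_flow_domain_of_attraction_normal
    {n r : ℕ} (hr : 0 < r) (hrn : r < n)
    (A : Matrix (Fin n) (Fin n) ℝ) (hnormal : A * Aᵀ = Aᵀ * A)
    (S : Matrix (Fin n) (Fin n) ℂ) (hS : S ∈ Matrix.unitaryGroup (Fin n) ℂ)
    (D : Fin n → ℂ)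
    (hdiag : Sᴴ * A.map Complex.ofReal * S = Matrix.diagonal D)
    (horder : ∀ i j : Fin n, i ≤ j → (D j).re ≤ (D i).re)
    (hgap : (D ⟨r, hrn⟩).re < (D ⟨r - 1, by omega⟩).re)
    (U : ℝ → Matrix (Fin n) (Fin r) ℝ)
    (hode : ∀ t : ℝ, 0 ≤ t → ∀ (i : Fin n) (j : Fin r),
      HasDerivAt (fun s : ℝ => U s i j)
        ((((1 : Matrix (Fin n) (Fin n) ℝ) - U t * (U t)ᵀ) * A * U t) i j) t)
    (hinit : (U 0)ᵀ * U 0 = (1 : Matrix (Fin r) (Fin r) ℝ))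
    (F2 : ℝ → Matrix (Fin (n - r)) (Fin r) ℂ)
    (hF2 : ∀ t : ℝ, F2 t = (Sᴴ * (U t).map Complex.ofReal).submatrix embBot id)
    (hdom : ((1 : Matrix (Fin r) (Fin r) ℂ) - (F2 0)ᴴ * F2 0).PosDef) :
    Tendsto F2 atTop (nhds 0) := by
  set V : ℝ → Matrix (Fin n) (Fin r) ℂ := fun t => Sᴴ * (U t).map Complex.ofReal with hV
  set K : ℝ → Matrix (Fin r) (Fin r) ℂ := fun t => ((U t)ᵀ * A * U t).map Complex.ofReal with hK
  have hUU := oja_flow_mem_stiefel A U hode hinit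
  have hUcont : ∀ i j, ContinuousOn (fun s => U s i j) (Set.Ici 0) := fun i j t ht =>
    (hode t ht i j).continuousAt.continuousWithinAt
  have hKcont : ∀ i j, ContinuousOn (fun s => K s i j) (Set.Ici 0) := by
    intro i j
    simp only [hK, Matrix.map_apply, Matrix.mul_apply, Matrix.transpose_apply]
    fun_prop (disch := assumption)
  have hSS : S * Sᴴ = 1 := (Matrix.mem_unitaryGroup_iff).1 hS
  have hVV : ∀ t, 0 ≤ t → (V t)ᴴ * V t = 1 := by
    intro t ht
    have h1 : (V t)ᴴ * V t
        = ((U t).map Complex.ofReal)ᴴ * (S * Sᴴ) * (U t).map Complex.ofReal := by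
      simp only [hV, Matrix.conjTranspose_mul, Matrix.conjTranspose_conjTranspose,
        Matrix.mul_assoc]
    rw [h1, hSS, Matrix.mul_one, conjTranspose_map_ofReal, ← map_ofReal_mul, hUU t ht]
    simp
  have hVode : ∀ t, 0 ≤ t → ∀ i j, HasDerivAt (fun s => V s i j)
      (D i * V t i j - (V t * K t) i j) t := by
    intro t ht i j
    have h1 : D i * V t i j - (V t * K t) i j
        = (Sᴴ * (((1 : Matrix (Fin n) (Fin n) ℝ) - U t * (U t)ᵀ) * A * U t).map
          Complex.ofReal) i j := by
      have h2 : Sᴴ * A.map Complex.ofReal = Matrix.diagonal D * Sᴴ := by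
        rw [← hdiag, Matrix.mul_assoc _ S, hSS, Matrix.mul_one]
      have h3 : (1 - U t * (U t)ᵀ) * A * U t = A * U t - U t * ((U t)ᵀ * A * U t) := by
        simp only [Matrix.sub_mul, Matrix.one_mul, Matrix.mul_assoc]
      rw [h3, Matrix.map_sub _ (fun a b => Complex.ofReal_sub a b), map_ofReal_mul, map_ofReal_mul,
        Matrix.mul_sub, ← Matrix.mul_assoc, h2, Matrix.mul_assoc (Matrix.diagonal D),
        ← Matrix.mul_assoc Sᴴ, Matrix.sub_apply, Matrix.diagonal_mul]
    rw [h1]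
    simp only [hV, Matrix.mul_apply (M := Sᴴ), Matrix.map_apply]
    exact HasDerivAt.fun_sum fun k _ => ((hode t ht k j).ofReal_comp).const_mul _
  have hbot : ∀ t i j, F2 t i j = V t (embBot i) j := fun t i j => by rw [hF2]; rfl
  set F1 : ℝ → Matrix (Fin r) (Fin r) ℂ := fun t => (V t).submatrix (Fin.castLE hrn.le) id with hF1
  have hF1unit : IsUnit (F1 0) := by
    have h1 : (F1 0)ᴴ * F1 0 = 1 - (F2 0)ᴴ * F2 0 := by
      rw [← hVV 0 le_rfl]
      ext i j
      simp only [Matrix.sub_apply, Matrix.mul_apply, Matrix.conjTranspose_apply, hbot, hF1,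
        sum_eq_sum_castLE_add_sum_embBot hrn.le, Matrix.submatrix_apply, id]
      ring
    have h2 : IsUnit ((F1 0)ᴴ * F1 0) := h1 ▸ hdom.isUnit
    exact isUnit_of_mul_isUnit_right h2
  set G0 := F2 0 * (F1 0)⁻¹ with hG0
  set G : ℝ → Matrix (Fin (n - r)) (Fin r) ℂ := fun t => Matrix.of fun i j =>
    Complex.exp ((D (embBot i) - D (Fin.castLE hrn.le j)) * (t : ℂ)) * G0 i j with hG
  have hGode : ∀ t i j, HasDerivAt (fun s => G s i j)
      ((D (embBot i) - D (Fin.castLE hrn.le j)) * G t i j) t := by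
    intro t i j
    have := ((((hasDerivAt_id t).ofReal_comp).const_mul
      (D (embBot i) - D (Fin.castLE hrn.le j))).cexp).mul_const (G0 i j)
    refine this.congr_deriv ?_
    simp only [hG, Matrix.of_apply, id, Complex.ofReal_one]
    ring
  have hE : ∀ t, 0 ≤ t → F2 t - G t * F1 t = 0 := by
    refine eq_zero_of_hasDerivAt_mul_add_mul
      (P := fun _ => Matrix.diagonal fun i => D (embBot i)) (Q := fun t => - K t)
      (fun i j => continuousOn_const) (fun i j => (hKcont i j).neg) ?_ ?_
    · intro t ht i j
      have h1 : (fun s => (F2 s - G s * F1 s) i j)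
          = fun s => V s (embBot i) j - ∑ k, G s i k * V s (Fin.castLE hrn.le k) j := by
        funext s
        simp [hbot, Matrix.mul_apply, hF1]
      rw [h1]
      have h2 := (hVode t ht (embBot i) j).fun_sub (HasDerivAt.fun_sum (u := Finset.univ) fun k _ =>
        (hGode t i k).fun_mul (hVode t ht (Fin.castLE hrn.le k) j))
      refine h2.congr_deriv ?_
      have h3 : ((F2 t - G t * F1 t) * -K t) i j
          = - (V t * K t) (embBot i) j
            + ∑ k, G t i k * (V t * K t) (Fin.castLE hrn.le k) j := by
        have h4 : (F2 t - G t * F1 t) * -K t = - (F2 t * K t) + G t * (F1 t * K t) := by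
          rw [Matrix.mul_neg, Matrix.sub_mul, Matrix.mul_assoc]; abel
        rw [h4]
        simp [Matrix.mul_apply, hbot, hF1]
      rw [Matrix.add_apply, h3, Matrix.diagonal_mul]
      simp only [Matrix.sub_apply, hbot, Matrix.mul_apply (M := G t), hF1, Matrix.submatrix_apply,
        id, mul_sub, Finset.mul_sum]
      rw [sub_add_eq_add_sub, ← sub_eq_zero]
      simp only [add_sub, sub_mul, Finset.sum_add_distrib, Finset.sum_sub_distrib, mul_assoc,
        mul_left_comm (D _) (G _ _ _)]
      ring_nf
    · have h1 : G 0 = G0 := by ext i j; simp [hG]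
      rw [h1, hG0, Matrix.mul_assoc,
        Matrix.nonsing_inv_mul _ ((Matrix.isUnit_iff_isUnit_det _).1 hF1unit), Matrix.mul_one,
        sub_self]
  have hVle : ∀ t, 0 ≤ t → ∀ i j, ‖V t i j‖ ≤ 1 := fun t ht =>
    norm_apply_le_one_of_conjTranspose_mul_self (hVV t ht)
  have hGlim : ∀ i k, Tendsto (fun t => G t i k) atTop (nhds 0) := by
    intro i k
    have hneg : (D (embBot i) - D (Fin.castLE hrn.le k)).re < 0 := by
      have h1 := horder ⟨r, hrn⟩ (embBot i) (by simp [embBot, Fin.le_def])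
      have h2 := horder (Fin.castLE hrn.le k) ⟨r - 1, by omega⟩ (by
        simp only [Fin.le_def, Fin.val_castLE]; omega)
      rw [Complex.sub_re]; linarith
    have h1 : Tendsto (fun t : ℝ =>
        Complex.exp ((D (embBot i) - D (Fin.castLE hrn.le k)) * (t : ℂ))) atTop (nhds 0) := by
      rw [tendsto_zero_iff_norm_tendsto_zero]
      simp only [Complex.norm_exp, Complex.re_mul_ofReal]
      exact Real.tendsto_exp_atBot.comp (tendsto_id.const_mul_atTop_of_neg hneg)
    simpa [hG] using h1.mul_const (G0 i k)
  refine tendsto_pi_nhds.2 fun i => tendsto_pi_nhds.2 fun j => ?_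
  have hlim : Tendsto (fun t => ∑ k, ‖G t i k‖) atTop (nhds 0) := by
    simpa using tendsto_finsetSum Finset.univ fun k _ => (hGlim i k).norm
  refine squeeze_zero_norm' ?_ hlim
  filter_upwards [eventually_ge_atTop 0] with t ht
  rw [sub_eq_zero.1 (hE t ht), Matrix.mul_apply]
  refine (norm_sum_le _ _).trans (Finset.sum_le_sum fun k _ => ?_)
  rw [norm_mul]
  exact mul_le_of_le_one_right (norm_nonneg _) (hVle t ht _ _)
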